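/- arXiv:1812.09504 — 3 statements merged into one kernel-verified Lean document; each statement's English description precedes it below -/
import Mathlib

section
/- Let A ∈ ℝ^{d×d}, let ε ∈ ℝ, and let P, Q be real symmetric positive definite d×d matrices satisfying (A − εI)ᵀ P + P (A − εI) = −Q. Then for every ξ ∈ ℝ^d and every t ≥ 0, ⟨P exp(A t) ξ, exp(A t) ξ⟩ ≥ exp((2ε − λ_max(Q)/λ_min(P)) · t) · ⟨P ξ, ξ⟩. -/
open Matrix

attribute [local instance] Matrix.linftyOpNormedRing Matrix.linftyOpNormedAlgebra

/-- The smallest eigenvalue of a real matrix, i.e. the infimum of its real spectrum. -/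
noncomputable def lamMin {d : ℕ} (M : Matrix (Fin d) (Fin d) ℝ) : ℝ :=
  sInf (spectrum ℝ M)

/-- The largest eigenvalue of a real matrix, i.e. the supremum of its real spectrum. -/
noncomputable def lamMax {d : ℕ} (M : Matrix (Fin d) (Fin d) ℝ) : ℝ :=
  sSup (spectrum ℝ M)

theorem Matrix.PosDef.lamMin_pos {d : ℕ} [NeZero d] {M : Matrix (Fin d) (Fin d) ℝ}
    (hM : M.PosDef) : 0 < lamMin M := by
  have hmem : lamMin M ∈ spectrum ℝ M :=
    Set.Nonempty.csInf_mem ⟨_, hM.isHermitian.eigenvalues_mem_spectrum_real 0⟩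
      M.finite_real_spectrum
  rw [hM.isHermitian.spectrum_real_eq_range_eigenvalues] at hmem
  obtain ⟨i, hi⟩ := hmem
  exact hi ▸ hM.eigenvalues_pos i

theorem Matrix.PosDef.lamMax_nonneg {d : ℕ} {M : Matrix (Fin d) (Fin d) ℝ}
    (hM : M.PosDef) : 0 ≤ lamMax M := by
  refine Real.sSup_nonneg fun x hx => ?_
  rw [hM.isHermitian.spectrum_real_eq_range_eigenvalues] at hx
  obtain ⟨i, rfl⟩ := hx
  exact (hM.eigenvalues_pos i).le

theorem Matrix.IsHermitian.mulVec_dotProduct_le_lamMax {d : ℕ} {M : Matrix (Fin d) (Fin d) ℝ}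
    (hM : M.IsHermitian) (v : Fin d → ℝ) : M *ᵥ v ⬝ᵥ v ≤ lamMax M * (v ⬝ᵥ v) := by
  have hH : (algebraMap ℝ (Matrix (Fin d) (Fin d) ℝ) (lamMax M) - M).IsHermitian := by
    rw [Algebra.algebraMap_eq_smul_one]
    exact (isHermitian_one.smul (IsSelfAdjoint.all _)).sub hM
  have hpsd : (algebraMap ℝ (Matrix (Fin d) (Fin d) ℝ) (lamMax M) - M).PosSemidef := by
    refine hH.posSemidef_iff_eigenvalues_nonneg.mpr fun i => ?_
    have hi := hH.eigenvalues_mem_spectrum_real i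
    rw [← spectrum.singleton_sub_eq, Set.singleton_sub] at hi
    obtain ⟨x, hx, hxi⟩ := hi
    have := le_csSup M.finite_real_spectrum.bddAbove hx
    exact (sub_nonneg.mpr this).trans_eq hxi
  have := hpsd.dotProduct_mulVec_nonneg v
  simp only [Algebra.algebraMap_eq_smul_one, sub_mulVec, smul_mulVec, one_mulVec, star_trivial,
    dotProduct_sub, dotProduct_smul, smul_eq_mul] at this
  rw [dotProduct_comm]
  linarith

theorem Matrix.IsHermitian.lamMin_le_mulVec_dotProduct {d : ℕ} {M : Matrix (Fin d) (Fin d) ℝ}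
    (hM : M.IsHermitian) (v : Fin d → ℝ) : lamMin M * (v ⬝ᵥ v) ≤ M *ᵥ v ⬝ᵥ v := by
  have hH : (M - algebraMap ℝ (Matrix (Fin d) (Fin d) ℝ) (lamMin M)).IsHermitian := by
    rw [Algebra.algebraMap_eq_smul_one]
    exact hM.sub (isHermitian_one.smul (IsSelfAdjoint.all _))
  have hpsd : (M - algebraMap ℝ (Matrix (Fin d) (Fin d) ℝ) (lamMin M)).PosSemidef := by
    refine hH.posSemidef_iff_eigenvalues_nonneg.mpr fun i => ?_
    have hi := hH.eigenvalues_mem_spectrum_real i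
    rw [← spectrum.sub_singleton_eq, Set.sub_singleton] at hi
    obtain ⟨x, hx, hxi⟩ := hi
    have := csInf_le M.finite_real_spectrum.bddBelow hx
    exact (sub_nonneg.mpr this).trans_eq hxi
  have := hpsd.dotProduct_mulVec_nonneg v
  simp only [Algebra.algebraMap_eq_smul_one, sub_mulVec, smul_mulVec, one_mulVec, star_trivial,
    dotProduct_sub, dotProduct_smul, smul_eq_mul] at this
  rw [dotProduct_comm (M *ᵥ v)]
  linarith

theorem Matrix.PosDef.mulVec_dotProduct_le_div {d : ℕ} {P Q : Matrix (Fin d) (Fin d) ℝ}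
    (hP : P.PosDef) (hQ : Q.PosDef) (v : Fin d → ℝ) :
    Q *ᵥ v ⬝ᵥ v ≤ lamMax Q / lamMin P * (P *ᵥ v ⬝ᵥ v) := by
  rcases Nat.eq_zero_or_pos d with rfl | hd
  · simp [dotProduct]
  have : NeZero d := ⟨hd.ne'⟩
  have hmin := hP.lamMin_pos
  calc Q *ᵥ v ⬝ᵥ v ≤ lamMax Q * (v ⬝ᵥ v) := hQ.isHermitian.mulVec_dotProduct_le_lamMax v
    _ = lamMax Q / lamMin P * (lamMin P * (v ⬝ᵥ v)) := by field_simp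
    _ ≤ lamMax Q / lamMin P * (P *ᵥ v ⬝ᵥ v) :=
      mul_le_mul_of_nonneg_left (hP.isHermitian.lamMin_le_mulVec_dotProduct v)
        (div_nonneg hQ.lamMax_nonneg hmin.le)

theorem HasDerivAt.dotProduct {n : Type*} [Fintype n] {f g : ℝ → n → ℝ} {f' g' : n → ℝ} {t : ℝ}
    (hf : HasDerivAt f f' t) (hg : HasDerivAt g g' t) :
    HasDerivAt (fun s => f s ⬝ᵥ g s) (f' ⬝ᵥ g t + f t ⬝ᵥ g') t := by
  simp only [_root_.dotProduct, ← Finset.sum_add_distrib]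
  exact HasDerivAt.fun_sum fun i _ => (hasDerivAt_pi.mp hf i).mul (hasDerivAt_pi.mp hg i)

theorem HasDerivAt.const_mulVec {m n : Type*} [Fintype m] [Fintype n] (M : Matrix m n ℝ)
    {f : ℝ → n → ℝ} {f' : n → ℝ} {t : ℝ} (hf : HasDerivAt f f' t) :
    HasDerivAt (fun s => M *ᵥ f s) (M *ᵥ f') t :=
  M.mulVecLin.toContinuousLinearMap.hasFDerivAt.comp_hasDerivAt t hf

theorem hasDerivAt_exp_smul_mulVec {d : ℕ} (A : Matrix (Fin d) (Fin d) ℝ) (ξ : Fin d → ℝ)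
    (t : ℝ) :
    HasDerivAt (fun s : ℝ => NormedSpace.exp (s • A) *ᵥ ξ)
      (A *ᵥ (NormedSpace.exp (t • A) *ᵥ ξ)) t := by
  have h := hasDerivAt_exp_smul_const' (𝕂 := ℝ) A t
  rw [mulVec_mulVec]
  exact ((mulVecBilin ℝ ℝ).flip ξ).toContinuousLinearMap.hasFDerivAt.comp_hasDerivAt t h

theorem lyapunov_shifted_quadratic_form {d : ℕ} {A P Q : Matrix (Fin d) (Fin d) ℝ} {ε : ℝ}
    (hLyap : (A - ε • (1 : Matrix (Fin d) (Fin d) ℝ))ᵀ * P +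
        P * (A - ε • (1 : Matrix (Fin d) (Fin d) ℝ)) = -Q) (v : Fin d → ℝ) :
    P *ᵥ (A *ᵥ v) ⬝ᵥ v + P *ᵥ v ⬝ᵥ A *ᵥ v = 2 * ε * (P *ᵥ v ⬝ᵥ v) - Q *ᵥ v ⬝ᵥ v := by
  have h := congrArg (fun M => M *ᵥ v ⬝ᵥ v) hLyap
  simp only [add_mulVec, ← mulVec_mulVec, sub_mulVec, mulVec_sub, transpose_sub, transpose_smul,
    transpose_one, smul_mulVec, mulVec_smul, one_mulVec, add_dotProduct, sub_dotProduct,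
    smul_dotProduct, neg_mulVec, neg_dotProduct, smul_eq_mul] at h
  have hT : Aᵀ *ᵥ (P *ᵥ v) ⬝ᵥ v = P *ᵥ v ⬝ᵥ A *ᵥ v := by
    rw [mulVec_transpose, dotProduct_mulVec]
  linarith

theorem exp_mul_le_of_mul_le_deriv {V V' : ℝ → ℝ} {c : ℝ} (hV : ∀ t, HasDerivAt V (V' t) t)
    (hle : ∀ t, c * V t ≤ V' t) {t : ℝ} (ht : 0 ≤ t) : Real.exp (c * t) * V 0 ≤ V t := by
  have hd (s : ℝ) : HasDerivAt (fun s => Real.exp (-(c * s)) * V s)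
      (Real.exp (-(c * s)) * (V' s - c * V s)) s := by
    refine ((((hasDerivAt_id s).const_mul c).neg.exp).mul (hV s)).congr_deriv ?_
    simp only [Pi.neg_apply, id_eq]
    ring
  have hmono : Monotone fun s => Real.exp (-(c * s)) * V s :=
    monotone_of_hasDerivAt_nonneg hd fun s =>
      mul_nonneg (Real.exp_pos _).le (sub_nonneg.mpr (hle s))
  have h := mul_le_mul_of_nonneg_left (hmono ht) (Real.exp_pos (c * t)).le
  simpa [← mul_assoc, ← Real.exp_add] using h

/-- **Fact.**  If `P, Q` are symmetric positive definite and
`(A − εI)ᵀ P + P (A − εI) = −Q`, then along the flow `t ↦ exp(At) ξ` of `γ' = Aγ`,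
`⟨P exp(At) ξ, exp(At) ξ⟩ ≥ exp((2ε − λ_max(Q)/λ_min(P)) t) ⟨P ξ, ξ⟩` for all `t ≥ 0`. -/
theorem lyapunov_flow_lower_bound_shifted
    {d : ℕ} (A : Matrix (Fin d) (Fin d) ℝ) (ε : ℝ)
    (P Q : Matrix (Fin d) (Fin d) ℝ)
    (hP : P.PosDef) (hQ : Q.PosDef)
    (hLyap : (A - ε • (1 : Matrix (Fin d) (Fin d) ℝ))ᵀ * P +
        P * (A - ε • (1 : Matrix (Fin d) (Fin d) ℝ)) = -Q) :
    ∀ ξ : Fin d → ℝ, ∀ t : ℝ, 0 ≤ t →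
      Real.exp ((2 * ε - lamMax Q / lamMin P) * t) * (P.mulVec ξ ⬝ᵥ ξ) ≤
        P.mulVec ((NormedSpace.exp (t • A)).mulVec ξ) ⬝ᵥ
          (NormedSpace.exp (t • A)).mulVec ξ := by
  intro ξ t ht
  have h := exp_mul_le_of_mul_le_deriv (c := 2 * ε - lamMax Q / lamMin P)
    (fun s => ((hasDerivAt_exp_smul_mulVec A ξ s).const_mulVec P).dotProduct
      (hasDerivAt_exp_smul_mulVec A ξ s))
    (fun s => by
      rw [lyapunov_shifted_quadratic_form hLyap]
      linarith [hP.mulVec_dotProduct_le_div hQ (NormedSpace.exp (s • A) *ᵥ ξ)]) ht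
  simpa using h
end

section
/- Let P be a finite index set, A_p ∈ ℝ^{d×d} and P_p symmetric positive definite for each p ∈ P, and E ⊆ P × P. Suppose there are constants λ̌_p ∈ ℝ with ⟨P_p exp(A_p s) ξ, exp(A_p s) ξ⟩ ≥ exp(−λ̌_p s) ⟨P_p ξ, ξ⟩ for all s ≥ 0, ξ ∈ ℝ^d, and constants μ̌_{pq} > 0 with ⟨P_q ξ, ξ⟩ ≥ μ̌_{pq} ⟨P_p ξ, ξ⟩ for all ξ ∈ ℝ^d and (p,q) ∈ E. Let 0 = τ_0 < τ_1 < ⋯ < τ_N ≤ t be real numbers, let p_0, …, p_N ∈ P with (p_i, p_{i+1}) ∈ E for 0 ≤ i < N, set τ_{N+1} := t, and let x(t) = exp(A_{p_N}(t − τ_N)) · exp(A_{p_{N−1}}(τ_N − τ_{N−1})) ⋯ exp(A_{p_0}(τ_1 − τ_0)) x₀ for x₀ ∈ ℝ^d. Then ⟨P_{p_N} x(t), x(t)⟩ ≥ exp(−Σ_{i=0}^{N} λ̌_{p_i}(τ_{i+1} − τ_i)) · (∏_{i=0}^{N−1} μ̌_{p_i p_{i+1}}) · ⟨P_{p_0}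 x₀, x₀⟩. -/
open Matrix

attribute [local instance] Matrix.linftyOpNormedRing Matrix.linftyOpNormedAlgebra

/-- `prodFlow A p τ k` is the state-transition matrix
`exp(A_{p_{k-1}}(τ_k − τ_{k-1})) ⋯ exp(A_{p_0}(τ_1 − τ_0))`. -/
noncomputable def prodFlow {d : ℕ} {P : Type*} (A : P → Matrix (Fin d) (Fin d) ℝ)
    (p : ℕ → P) (τ : ℕ → ℝ) : ℕ → Matrix (Fin d) (Fin d) ℝ
  | 0 => 1
  | (k + 1) => NormedSpace.exp ((τ (k + 1) - τ k) • A (p k)) * prodFlow A p τ k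

/-- **Lemma (iterated Lyapunov-like bound).**  With Lyapunov-like lower bounds
`⟨P_p exp(A_p s) ξ, exp(A_p s) ξ⟩ ≥ exp(−λ̌_p s) ⟨P_p ξ, ξ⟩` and jump bounds
`⟨P_q ξ, ξ⟩ ≥ μ̌_{pq} ⟨P_p ξ, ξ⟩` for `(p,q) ∈ E`, along switching instants
`0 = τ_0 < τ_1 < ⋯ < τ_N ≤ t` (with `τ_{N+1} := t`) the solution
`x(t) = exp(A_{p_N}(t − τ_N)) ⋯ exp(A_{p_0}(τ_1 − τ_0)) x₀` satisfies
`⟨P_{p_N} x(t), x(t)⟩ ≥ exp(−Σ_{i≤N} λ̌_{p_i}(τ_{i+1}−τ_i)) (∏_{i<N} μ̌_{p_i p_{i+1}}) ⟨P_{p_0} x₀, x₀⟩`. -/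
theorem iterated_lyapunov_lower_bound
    {d : ℕ} {P : Type*} [Fintype P]
    (A : P → Matrix (Fin d) (Fin d) ℝ)
    (Pm : P → Matrix (Fin d) (Fin d) ℝ) (hPm : ∀ q, (Pm q).PosDef)
    (E : Set (P × P))
    (lam : P → ℝ)
    (hlam : ∀ q, ∀ s : ℝ, 0 ≤ s → ∀ ξ : Fin d → ℝ,
      Real.exp (-(lam q) * s) * ((Pm q).mulVec ξ ⬝ᵥ ξ) ≤
        (Pm q).mulVec ((NormedSpace.exp (s • A q)).mulVec ξ) ⬝ᵥ
          (NormedSpace.exp (s • A q)).mulVec ξ)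
    (mu : P × P → ℝ) (hmupos : ∀ e ∈ E, 0 < mu e)
    (hmu : ∀ e ∈ E, ∀ ξ : Fin d → ℝ,
      mu e * ((Pm e.1).mulVec ξ ⬝ᵥ ξ) ≤ (Pm e.2).mulVec ξ ⬝ᵥ ξ)
    (N : ℕ) (t : ℝ) (τ : ℕ → ℝ) (hτ0 : τ 0 = 0)
    (hτmono : ∀ i < N, τ i < τ (i + 1)) (hτN : τ N ≤ t)
    (hτlast : τ (N + 1) = t)
    (p : ℕ → P) (hpE : ∀ i < N, (p i, p (i + 1)) ∈ E)
    (x₀ : Fin d → ℝ) :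
    Real.exp (-(∑ i ∈ Finset.range (N + 1), lam (p i) * (τ (i + 1) - τ i))) *
        ((∏ i ∈ Finset.range N, mu (p i, p (i + 1))) *
          ((Pm (p 0)).mulVec x₀ ⬝ᵥ x₀)) ≤
      (Pm (p N)).mulVec ((prodFlow A p τ (N + 1)).mulVec x₀) ⬝ᵥ
        (prodFlow A p τ (N + 1)).mulVec x₀ := by
  have hτle : ∀ k ≤ N, τ k ≤ τ (k + 1) := fun k hk => by
    rcases hk.lt_or_eq with h | rfl
    · exact (hτmono k h).le
    · exact hτN.trans_eq hτlast.symm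
  have hmu_nonneg : ∀ i < N, 0 ≤ mu (p i, p (i + 1)) := fun i hi =>
    (hmupos _ (hpE i hi)).le
  have flow_step : ∀ k ≤ N, ∀ ξ : Fin d → ℝ,
      Real.exp (-(lam (p k) * (τ (k + 1) - τ k))) * ((Pm (p k)).mulVec ξ ⬝ᵥ ξ) ≤
        (Pm (p k)).mulVec ((NormedSpace.exp ((τ (k + 1) - τ k) • A (p k))).mulVec ξ) ⬝ᵥ
          (NormedSpace.exp ((τ (k + 1) - τ k) • A (p k))).mulVec ξ := fun k hk ξ => by
    simpa only [neg_mul] using hlam (p k) _ (sub_nonneg.2 (hτle k hk)) ξ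
  have bound : ∀ k ≤ N,
      Real.exp (-(∑ i ∈ Finset.range (k + 1), lam (p i) * (τ (i + 1) - τ i))) *
          ((∏ i ∈ Finset.range k, mu (p i, p (i + 1))) *
            ((Pm (p 0)).mulVec x₀ ⬝ᵥ x₀)) ≤
        (Pm (p k)).mulVec ((prodFlow A p τ (k + 1)).mulVec x₀) ⬝ᵥ
          (prodFlow A p τ (k + 1)).mulVec x₀ := by
    intro k
    induction k with
    | zero =>
      intro hk
      simpa [prodFlow] using flow_step 0 hk x₀
    | succ k ih =>
      intro hk
      have hflow := flow_step (k + 1) hk ((prodFlow A p τ (k + 1)).mulVec x₀)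
      rw [prodFlow, ← mulVec_mulVec]
      refine le_trans ?_ hflow
      have hjump := hmu _ (hpE k hk) ((prodFlow A p τ (k + 1)).mulVec x₀)
      have hind := mul_le_mul_of_nonneg_left (ih (Nat.le_of_succ_le hk)) (hmu_nonneg k hk)
      rw [Finset.sum_range_succ _ (k + 1), Finset.prod_range_succ, neg_add, Real.exp_add]
      calc _ = Real.exp (-(lam (p (k + 1)) * (τ (k + 1 + 1) - τ (k + 1)))) *
              (mu (p k, p (k + 1)) *
                (Real.exp (-(∑ i ∈ Finset.range (k + 1), lam (p i) * (τ (i + 1) - τ i))) *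
                  ((∏ i ∈ Finset.range k, mu (p i, p (i + 1))) *
                    ((Pm (p 0)).mulVec x₀ ⬝ᵥ x₀)))) := by ring
        _ ≤ _ := mul_le_mul_of_nonneg_left (hind.trans hjump) (Real.exp_nonneg _)
  exact bound N le_rfl
end

section
/- Let A₁ = [[−1/5, −2/5],[3, −1/5]] and A₂ = [[−1/5, −3],[2/5, −1/5]] (both 2×2 real matrices). There exist symmetric positive definite 2×2 matrices P₁, P₂ with A_pᵀ P_p + P_p A_p = −I for p = 1, 2, and for any such P₁, P₂, setting λ̂_p := 1/λ_max(P_p), λ̌_p := 1/λ_min(P_p), μ̂_{pq} := λ_max(P_p^{-1/2} P_q P_p^{-1/2}) and μ̌_{pq} := λ_min(P_p^{-1/2} P_q P_p^{-1/2}) for (p,q) ∈ {(1,2),(2,1)}, the following two inequalities hold: (1/10)·(1/2)·(ln μ̂_{12} + ln μ̂_{21}) − (1/2)·(λ̂_1 + λ̂_2) > 0, and (1/10)·(1/2)·(ln μ̌_{12} + ln μ̌_{21}) − (1/2)·(λ̌_1 + λ̌_2) < 0. (Hence the switching signal with switching frequency 1/10, transition frequencies 1/2 and activation fractions 1/2 satisfies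 neither the asymptotic stability condition nor the asymptotic instability condition.) -/
open Matrix
open scoped MatrixOrder

theorem mem_spectrum_fin_two {M : Matrix (Fin 2) (Fin 2) ℝ} {x : ℝ} :
    x ∈ spectrum ℝ M ↔ x ^ 2 - M.trace * x + M.det = 0 := by
  rw [Matrix.mem_spectrum_iff_isRoot_charpoly, Matrix.charpoly_fin_two]
  simp [Polynomial.IsRoot]

/-- A `2 × 2` real matrix whose characteristic polynomial is negative at some `c` has two real
eigenvalues, and `c` lies strictly between them. -/
theorem exists_spectrum_fin_two_eq_pair {M : Matrix (Fin 2) (Fin 2) ℝ} {c : ℝ}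
    (hc : c ^ 2 - M.trace * c + M.det < 0) :
    ∃ x y, spectrum ℝ M = {x, y} ∧ x < c ∧ c < y ∧ x * y = M.det := by
  have hD : 0 ≤ M.trace ^ 2 - 4 * M.det := by nlinarith [sq_nonneg (M.trace - 2 * c)]
  set r := √(M.trace ^ 2 - 4 * M.det)
  have hr0 : 0 ≤ r := Real.sqrt_nonneg _
  have hr2 : r ^ 2 = M.trace ^ 2 - 4 * M.det := Real.sq_sqrt hD
  have hlt : -r < 2 * c - M.trace ∧ 2 * c - M.trace < r :=
    abs_lt_of_sq_lt_sq' (by rw [hr2]; nlinarith) hr0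
  refine ⟨(M.trace - r) / 2, (M.trace + r) / 2, ?_, by linarith, by linarith,
    by linear_combination -hr2 / 4⟩
  ext z
  rw [mem_spectrum_fin_two, Set.mem_insert_iff, Set.mem_singleton_iff,
    ← sub_eq_zero (b := (M.trace - r) / 2), ← sub_eq_zero (b := (M.trace + r) / 2),
    ← mul_eq_zero]
  constructor <;> intro h
  · linear_combination h - hr2 / 4
  · linear_combination h + hr2 / 4

/-- If the characteristic polynomial of a `2 × 2` real matrix is negative at `c`, then `c` lies
strictly between the extreme eigenvalues, whose product is the determinant. -/
theorem lamMin_lt_lt_lamMax {M : Matrix (Fin 2) (Fin 2) ℝ} {c : ℝ}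
    (hc : c ^ 2 - M.trace * c + M.det < 0) :
    lamMin M < c ∧ c < lamMax M ∧ lamMin M * lamMax M = M.det := by
  obtain ⟨x, y, hs, hx, hy, hxy⟩ := exists_spectrum_fin_two_eq_pair hc
  rw [lamMin, lamMax, hs, csInf_pair, csSup_pair, inf_eq_left.mpr (hx.trans hy).le,
    sup_eq_right.mpr (hx.trans hy).le]
  exact ⟨hx, hy, hxy⟩

theorem posDef_fin_two_of {a b c : ℝ} (ha : 0 < a) (h : 0 < a * c - b * b) :
    (!![a, b; b, c] : Matrix (Fin 2) (Fin 2) ℝ).PosDef := by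
  refine Matrix.PosDef.of_dotProduct_mulVec_pos ?_ fun x hx ↦ ?_
  · ext i j
    fin_cases i <;> fin_cases j <;> simp
  · have key : a * (star x ⬝ᵥ !![a, b; b, c] *ᵥ x) =
        (a * x 0 + b * x 1) ^ 2 + (a * c - b * b) * x 1 ^ 2 := by
      simp [Matrix.mulVec, dotProduct, Fin.sum_univ_two]
      ring
    refine pos_of_mul_pos_right (a := a) ?_ ha.le
    rw [key]
    rcases eq_or_ne (x 1) 0 with h1 | h1
    · have h0 : x 0 ≠ 0 := fun h0 ↦ hx (by ext i; fin_cases i <;> simp [h0, h1])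
      rw [h1, mul_zero, add_zero, zero_pow two_ne_zero, mul_zero, add_zero]
      positivity
    · exact add_pos_of_nonneg_of_pos (sq_nonneg _) (mul_pos h (by positivity))

theorem sqrt_inv_mul_sqrt_inv {n : Type*} [Fintype n] [DecidableEq n] {P : Matrix n n ℝ}
    (hP : P.PosDef) : (CFC.sqrt P)⁻¹ * (CFC.sqrt P)⁻¹ = P⁻¹ := by
  rw [← Matrix.mul_inv_rev, CFC.sqrt_mul_sqrt_self P hP.posSemidef.nonneg]

theorem trace_sqrt_inv_conj {n : Type*} [Fintype n] [DecidableEq n] {P : Matrix n n ℝ}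
    (hP : P.PosDef) (Q : Matrix n n ℝ) :
    ((CFC.sqrt P)⁻¹ * Q * (CFC.sqrt P)⁻¹).trace = (P.adjugate * Q).trace / P.det := by
  rw [Matrix.trace_mul_cycle, sqrt_inv_mul_sqrt_inv hP, Matrix.inv_def, Matrix.smul_mul,
    Matrix.trace_smul, Ring.inverse_eq_inv', smul_eq_mul, inv_mul_eq_div]

theorem det_sqrt_inv_conj {n : Type*} [Fintype n] [DecidableEq n] {P : Matrix n n ℝ}
    (hP : P.PosDef) (Q : Matrix n n ℝ) :
    ((CFC.sqrt P)⁻¹ * Q * (CFC.sqrt P)⁻¹).det = Q.det / P.det := by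
  rw [Matrix.det_mul_right_comm, sqrt_inv_mul_sqrt_inv hP, Matrix.det_mul, Matrix.det_nonsing_inv,
    Ring.inverse_eq_inv', inv_mul_eq_div]

/-- **Proposition (a switching signal in the gap).**  For
`A₁ = [[−1/5, −2/5],[3, −1/5]]` and `A₂ = [[−1/5, −3],[2/5, −1/5]]` there exist symmetric
positive definite `P₁, P₂` with `A_pᵀ P_p + P_p A_p = −I`; and for any such `P₁, P₂`,
setting `λ̂_p := 1/λ_max(P_p)`, `λ̌_p := 1/λ_min(P_p)`,
`μ̂_{pq} := λ_max(P_p^{-1/2} P_q P_p^{-1/2})` and `μ̌_{pq} := λ_min(P_p^{-1/2} P_q P_p^{-1/2})`,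
both `(1/10)(1/2)(ln μ̂₁₂ + ln μ̂₂₁) − (1/2)(λ̂₁ + λ̂₂) > 0` and
`(1/10)(1/2)(ln μ̌₁₂ + ln μ̌₂₁) − (1/2)(λ̌₁ + λ̌₂) < 0` hold. -/
theorem gap_example :
    (∃ P₁ P₂ : Matrix (Fin 2) (Fin 2) ℝ, P₁.PosDef ∧ P₂.PosDef ∧
      (!![-1/5, -2/5; 3, -1/5] : Matrix (Fin 2) (Fin 2) ℝ)ᵀ * P₁ +
          P₁ * !![-1/5, -2/5; 3, -1/5] = -(1 : Matrix (Fin 2) (Fin 2) ℝ) ∧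
      (!![-1/5, -3; 2/5, -1/5] : Matrix (Fin 2) (Fin 2) ℝ)ᵀ * P₂ +
          P₂ * !![-1/5, -3; 2/5, -1/5] = -(1 : Matrix (Fin 2) (Fin 2) ℝ)) ∧
    ∀ P₁ P₂ : Matrix (Fin 2) (Fin 2) ℝ, ∀ hP₁ : P₁.PosDef, ∀ hP₂ : P₂.PosDef,
      (!![-1/5, -2/5; 3, -1/5] : Matrix (Fin 2) (Fin 2) ℝ)ᵀ * P₁ +
          P₁ * !![-1/5, -2/5; 3, -1/5] = -(1 : Matrix (Fin 2) (Fin 2) ℝ) →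
      (!![-1/5, -3; 2/5, -1/5] : Matrix (Fin 2) (Fin 2) ℝ)ᵀ * P₂ +
          P₂ * !![-1/5, -3; 2/5, -1/5] = -(1 : Matrix (Fin 2) (Fin 2) ℝ) →
      (0 < (1/10 : ℝ) * (1/2) *
          (Real.log (lamMax ((CFC.sqrt P₁)⁻¹ * P₂ * (CFC.sqrt P₁)⁻¹)) +
           Real.log (lamMax ((CFC.sqrt P₂)⁻¹ * P₁ * (CFC.sqrt P₂)⁻¹))) -
        (1/2 : ℝ) * (1 / lamMax P₁ + 1 / lamMax P₂)) ∧
      ((1/10 : ℝ) * (1/2) *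
          (Real.log (lamMin ((CFC.sqrt P₁)⁻¹ * P₂ * (CFC.sqrt P₁)⁻¹)) +
           Real.log (lamMin ((CFC.sqrt P₂)⁻¹ * P₁ * (CFC.sqrt P₂)⁻¹))) -
        (1/2 : ℝ) * (1 / lamMin P₁ + 1 / lamMin P₂) < 0) := by
  have d₁ : (!![1285/124, 65/124; 65/124, 180/124] : Matrix (Fin 2) (Fin 2) ℝ).det =
      25 * 9083 / 124 ^ 2 := by rw [det_fin_two_of]; norm_num
  have d₂ : (!![180/124, -65/124; -65/124, 1285/124] : Matrix (Fin 2) (Fin 2) ℝ).det =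
      25 * 9083 / 124 ^ 2 := by rw [det_fin_two_of]; norm_num
  refine ⟨⟨!![1285/124, 65/124; 65/124, 180/124], !![180/124, -65/124; -65/124, 1285/124],
    posDef_fin_two_of (by norm_num) (by norm_num), posDef_fin_two_of (by norm_num) (by norm_num),
    ?_, ?_⟩, ?_⟩
  · ext i j
    fin_cases i <;> fin_cases j <;> norm_num [Matrix.mul_apply, Fin.sum_univ_two]
  · ext i j
    fin_cases i <;> fin_cases j <;> norm_num [Matrix.mul_apply, Fin.sum_univ_two]
  intro P₁ P₂ hP₁ hP₂ h₁ h₂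
  have e₁ : P₁ = !![1285/124, 65/124; 65/124, 180/124] := by
    have hs := hP₁.isHermitian.apply 0 1
    have h00 := congrFun (congrFun h₁ 0) 0
    have h01 := congrFun (congrFun h₁ 0) 1
    have h11 := congrFun (congrFun h₁ 1) 1
    simp [Matrix.mul_apply, Fin.sum_univ_two] at hs h00 h01 h11
    ext i j
    fin_cases i <;> fin_cases j <;> simp <;> linarith
  have e₂ : P₂ = !![180/124, -65/124; -65/124, 1285/124] := by
    have hs := hP₂.isHermitian.apply 0 1
    have h00 := congrFun (congrFun h₂ 0) 0
    have h01 := congrFun (congrFun h₂ 0) 1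
    have h11 := congrFun (congrFun h₂ 1) 1
    simp [Matrix.mul_apply, Fin.sum_univ_two] at hs h00 h01 h11
    ext i j
    fin_cases i <;> fin_cases j <;> simp <;> linarith
  have t₁ : P₁.trace = 1465 / 124 := by rw [e₁, trace_fin_two_of]; norm_num
  have t₂ : P₂.trace = 1465 / 124 := by rw [e₂, trace_fin_two_of]; norm_num
  have t₁₂ := trace_sqrt_inv_conj hP₁ P₂
  have t₂₁ := trace_sqrt_inv_conj hP₂ P₁
  have d₁₂ := det_sqrt_inv_conj hP₁ P₂
  have d₂₁ := det_sqrt_inv_conj hP₂ P₁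
  rw [← e₁] at d₁
  rw [← e₂] at d₂
  rw [d₁, d₂, div_self (by norm_num)] at d₁₂ d₂₁
  rw [d₁, e₁, e₂, adjugate_fin_two_of, mul_fin_two, trace_fin_two_of] at t₁₂
  rw [d₂, e₁, e₂, adjugate_fin_two_of, mul_fin_two, trace_fin_two_of] at t₂₁
  rw [← e₁, ← e₂] at t₁₂ t₂₁
  have one_lt_log {x : ℝ} (hx : 3 < x) : 1 < Real.log x := by
    rw [Real.lt_log_iff_exp_lt (by linarith)]
    linarith [Real.exp_one_lt_d9]
  obtain ⟨-, l₁, p₁⟩ := lamMin_lt_lt_lamMax (M := P₁) (c := 10) (by rw [t₁, d₁]; norm_num)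
  obtain ⟨-, l₂, p₂⟩ := lamMin_lt_lt_lamMax (M := P₂) (c := 10) (by rw [t₂, d₂]; norm_num)
  obtain ⟨-, l₁₂, p₁₂⟩ := lamMin_lt_lt_lamMax (c := 3) (by rw [t₁₂, d₁₂]; norm_num)
  obtain ⟨-, l₂₁, p₂₁⟩ := lamMin_lt_lt_lamMax (c := 3) (by rw [t₂₁, d₂₁]; norm_num)
  rw [d₁₂] at p₁₂
  rw [d₂₁] at p₂₁
  rw [eq_inv_of_mul_eq_one_left p₁₂, eq_inv_of_mul_eq_one_left p₂₁, Real.log_inv, Real.log_inv]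
  have g₁₂ := one_lt_log l₁₂
  have g₂₁ := one_lt_log l₂₁
  have u₁ : 1 / lamMax P₁ < 1 / 10 := one_div_lt_one_div_of_lt (by norm_num) l₁
  have u₂ : 1 / lamMax P₂ < 1 / 10 := one_div_lt_one_div_of_lt (by norm_num) l₂
  have v₁ : 0 < 1 / lamMin P₁ := one_div_pos.mpr <|
    pos_of_mul_pos_left (by rw [p₁, d₁]; norm_num) (by linarith : (0 : ℝ) ≤ lamMax P₁)
  have v₂ : 0 < 1 / lamMin P₂ := one_div_pos.mpr <|
    pos_of_mul_pos_left (by rw [p₂, d₂]; norm_num) (by linarith : (0 : ℝ) ≤ lamMax P₂)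
  constructor <;> linarith
end
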